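/- Let C be an m×n Cauchon diagram and let I ⊆ [m], J ⊆ [n] with |I| = |J| = k. Then Σ_{P ∈ N} sgn_q(P)·w(P) = 0, where N denotes the set of all (R_I,C_J)-path systems in the Cauchon graph G_C that are NOT vertex-disjoint. -/

import Mathlib

universe u

/-- Quantum affine space data: a central unit `q` and units `t i j`
satisfying the quantum affine space commutation relations. -/
structure QMData (R : Type u) [Ring R] (m n : ℕ) where
  q : Rˣ
  t : Fin m → Fin n → Rˣ
  q_central : ∀ r : R, (q : R) * r = r * (q : R)
  row_rel : ∀ (i : Fin m) ⦃j j' : Fin n⦄, j < j' →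
    (t i j : R) * (t i j' : R) = (q : R) * ((t i j' : R) * (t i j : R))
  col_rel : ∀ ⦃i i' : Fin m⦄ (j : Fin n), i < i' →
    (t i j : R) * (t i' j : R) = (q : R) * ((t i' j : R) * (t i j : R))
  mixed_rel : ∀ ⦃i i' : Fin m⦄ ⦃j j' : Fin n⦄, i < i' → j ≠ j' →
    (t i j : R) * (t i' j' : R) = (t i' j' : R) * (t i j : R)

/-- `white i j = true` means the square `(i,j)` is white.  The Cauchon
condition: for every black square, either every square above it or every
square to its left is also black. -/
def IsCauchon {m n : ℕ} (white : Fin m → Fin n → Bool) : Prop :=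
  ∀ i j, white i j = false →
    (∀ i' : Fin m, i' < i → white i' j = false) ∨
    (∀ j' : Fin n, j' < j → white i j' = false)

/-- Vertices of the Cauchon graph: white squares, row vertices `r_i`,
column vertices `c_j`. -/
inductive CVertex (m n : ℕ) where
  | sq : Fin m → Fin n → CVertex m n
  | row : Fin m → CVertex m n
  | col : Fin n → CVertex m n
deriving DecidableEq

/-- Directed edges of the Cauchon graph. -/
inductive CEdge {m n : ℕ} (white : Fin m → Fin n → Bool) :
    CVertex m n → CVertex m n → Prop where
  | fromRow (i : Fin m) (k : Fin n) :
      white i k = true → (∀ k' : Fin n, k < k' → white i k' = false) →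
      CEdge white (.row i) (.sq i k)
  | toCol (i : Fin m) (j : Fin n) :
      white i j = true → (∀ i' : Fin m, i < i' → white i' j = false) →
      CEdge white (.sq i j) (.col j)
  | horiz (i : Fin m) (k j : Fin n) :
      j < k → white i k = true → white i j = true →
      (∀ j' : Fin n, j < j' → j' < k → white i j' = false) →
      CEdge white (.sq i k) (.sq i j)
  | vert (i i' : Fin m) (j : Fin n) :
      i < i' → white i j = true → white i' j = true →
      (∀ l : Fin m, i < l → l < i' → white l j = false) →
      CEdge white (.sq i j) (.sq i' j)

/-- The weight of an edge of the Cauchon graph (1 on non-edges). -/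
def wt {R : Type u} {m n : ℕ} [Ring R] (D : QMData R m n) :
    CVertex m n → CVertex m n → R
  | .row i, .sq i' k => if i = i' then (D.t i' k : R) else 1
  | .sq i k, .sq i' j =>
      if i = i' ∧ j < k then (↑((D.t i k)⁻¹) * ↑(D.t i j) : R) else 1
  | _, _ => 1

/-- A pair of vertices spans a horizontal edge (edges from `r_i` are
horizontal; edges between squares are horizontal iff the rows agree). -/
def Horiz {m n : ℕ} : CVertex m n → CVertex m n → Prop
  | .row _, _ => True
  | .sq i _, .sq i' _ => i = i'
  | _, _ => False

/-- `l` is (the list of vertices of) a directed path from `u` to `v`. -/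
def IsPathFrom {m n : ℕ} (white : Fin m → Fin n → Bool) (u v : CVertex m n)
    (l : List (CVertex m n)) : Prop :=
  l.Chain' (CEdge white) ∧ l.head? = some u ∧ l.getLast? = some v

/-- The list of (endpoint pairs of the) edges of a path. -/
def steps {m n : ℕ} (l : List (CVertex m n)) : List (CVertex m n × CVertex m n) :=
  l.zip l.tail

/-- The weight of a path: the ordered product of its edge weights. -/
def pathWeight {R : Type u} {m n : ℕ} [Ring R] (D : QMData R m n)
    (l : List (CVertex m n)) : R :=
  ((steps l).map fun p => wt D p.1 p.2).prod

/-- The number of inversions (length) of a permutation of `Fin k`. -/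
def invCount {k : ℕ} (σ : Equiv.Perm (Fin k)) : ℕ :=
  ((Finset.univ : Finset (Fin k × Fin k)).filter fun p => p.1 < p.2 ∧ σ p.2 < σ p.1).card

/-- The quantum determinant of a `k × k` matrix over a (noncommutative) ring. -/
def qdet {R : Type u} [Ring R] {k : ℕ} (q : Rˣ) (N : Matrix (Fin k) (Fin k) R) : R :=
  ∑ σ : Equiv.Perm (Fin k),
    (-(q : R)) ^ invCount σ * ((List.finRange k).map fun i => N i (σ i)).prod

/-- The path matrix: entry `(i,j)` is the sum of the weights of all directed
paths from `r_i` to `c_j` (zero when there are none). -/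
noncomputable def pathMatrix {R : Type u} {m n : ℕ} [Ring R] (D : QMData R m n)
    (white : Fin m → Fin n → Bool) : Matrix (Fin m) (Fin n) R :=
  Matrix.of fun i j =>
    ∑ᶠ p : {l : List (CVertex m n) // IsPathFrom white (.row i) (.col j) l},
      pathWeight D p.1

/-- An `(R_I, C_J)`-path system: paths `P ℓ : r_{i_ℓ} ⇒ c_{j_{σ ℓ}}`. -/
structure PathSys {m n : ℕ} (white : Fin m → Fin n → Bool) {k : ℕ}
    (ι : Fin k → Fin m) (κ : Fin k → Fin n) where
  σ : Equiv.Perm (Fin k)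
  P : Fin k → List (CVertex m n)
  isPath : ∀ l : Fin k, IsPathFrom white (.row (ι l)) (.col (κ (σ l))) (P l)

/-- A path system is vertex-disjoint if no two of its paths share a vertex. -/
def PathSys.VertexDisjoint {m n : ℕ} {white : Fin m → Fin n → Bool} {k : ℕ}
    {ι : Fin k → Fin m} {κ : Fin k → Fin n} (S : PathSys white ι κ) : Prop :=
  ∀ a b : Fin k, a ≠ b → ∀ x : CVertex m n, x ∈ S.P a → x ∈ S.P b → False

/-- The weight of a path system: the ordered product `w(P₁)⋯w(P_k)`. -/
def PathSys.weight {R : Type u} {m n : ℕ} [Ring R] (D : QMData R m n)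
    {white : Fin m → Fin n → Bool} {k : ℕ} {ι : Fin k → Fin m} {κ : Fin k → Fin n}
    (S : PathSys white ι κ) : R :=
  ((List.finRange k).map fun l => pathWeight D (S.P l)).prod

/-- The `q`-sign of a path system: `(-q) ^ ℓ(σ_P)`. -/
def PathSys.sgnq {R : Type u} {m n : ℕ} [Ring R] (D : QMData R m n)
    {white : Fin m → Fin n → Bool} {k : ℕ} {ι : Fin k → Fin m} {κ : Fin k → Fin n}
    (S : PathSys white ι κ) : R :=
  (-(D.q : R)) ^ invCount S.σ

namespace CVertex

variable {m n : ℕ}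

/-- The row index of a vertex; column vertices lie below all rows. -/
def rowN : CVertex m n → ℕ
  | .sq i _ => i
  | .row i => i
  | .col _ => m

/-- The column index of a vertex; row vertices lie to the right of all columns. -/
def colN : CVertex m n → ℕ
  | .sq _ j => j
  | .row _ => n
  | .col j => j

/-- `Later x y`: the vertex `y` comes after `x` in the order that reads the rows from top to
bottom and each row from right to left. -/
def Later (x y : CVertex m n) : Prop :=
  x.rowN < y.rowN ∨ x.rowN = y.rowN ∧ y.colN < x.colN

lemma colN_le (x : CVertex m n) : x.colN ≤ n := by
  cases x <;> simp [colN]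

lemma rowN_le (x : CVertex m n) : x.rowN ≤ m := by
  cases x <;> simp [rowN]

lemma ext_rowN_colN {x y : CVertex m n} (h : x.rowN = y.rowN) (h' : x.colN = y.colN) :
    x = y := by
  cases x <;> cases y <;> simp [rowN, colN] at h h' ⊢ <;> grind

lemma later_trichotomy (x y : CVertex m n) : Later x y ∨ x = y ∨ Later y x := by
  by_cases h : x.rowN = y.rowN ∧ x.colN = y.colN
  · exact Or.inr (Or.inl (ext_rowN_colN h.1 h.2))
  · unfold Later; omega

lemma later_irrefl (x : CVertex m n) : ¬ Later x x := by
  unfold Later; omega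

/-- A monotone enumeration of the vertices along `Later`. -/
def key (x : CVertex m n) : ℕ := x.rowN * (n + 1) + (n - x.colN)

lemma key_lt_key {x y : CVertex m n} (h : Later x y) : x.key < y.key := by
  have hx := x.colN_le
  have hy := y.colN_le
  unfold key
  rcases h with h | ⟨h, h'⟩
  · have : (x.rowN + 1) * (n + 1) ≤ y.rowN * (n + 1) := Nat.mul_le_mul_right _ h
    rw [add_mul] at this
    omega
  · rw [h]; omega

lemma key_le (x : CVertex m n) : x.key ≤ m * (n + 1) + n := by
  have := Nat.mul_le_mul_right (n + 1) x.rowN_le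
  unfold key
  omega

end CVertex

open CVertex

section Paths

variable {m n : ℕ} {white : Fin m → Fin n → Bool}

lemma CEdge.rowN_le {u v : CVertex m n} (h : CEdge white u v) : u.rowN ≤ v.rowN := by
  cases h <;> simp [rowN]; omega

lemma CEdge.colN_le {u v : CVertex m n} (h : CEdge white u v) : v.colN ≤ u.colN := by
  cases h <;> simp [colN]; omega

lemma CEdge.later {u v : CVertex m n} (h : CEdge white u v) : Later u v := by
  cases h <;> simp [Later, colN, rowN] <;> omega

/-- The order relation between the vertices of a path. -/
def Precedes (u v : CVertex m n) : Prop :=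
  u.rowN ≤ v.rowN ∧ v.colN ≤ u.colN ∧ Later u v

instance : IsTrans (CVertex m n) Precedes where
  trans a b c h h' := by
    unfold Precedes Later at *
    omega

lemma CEdge.precedes {u v : CVertex m n} (h : CEdge white u v) : Precedes u v :=
  ⟨h.rowN_le, h.colN_le, h.later⟩

namespace IsPathFrom

variable {u v w x : CVertex m n} {l A B : List (CVertex m n)}

lemma pairwise (h : IsPathFrom white u v l) : l.Pairwise Precedes :=
  List.isChain_iff_pairwise.1 (h.1.imp fun _ _ h => h.precedes)

lemma suffix (h : IsPathFrom white u v (A ++ x :: B)) : IsPathFrom white x v (x :: B) := by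
  obtain ⟨h1, h2, h3⟩ := h
  refine ⟨(List.isChain_append.1 h1).2.1, rfl, ?_⟩
  rwa [List.getLast?_append_of_ne_nil _ (by simp)] at h3

lemma before (h : IsPathFrom white u v (A ++ x :: B)) : IsPathFrom white u x (A ++ [x]) := by
  obtain ⟨h1, h2, h3⟩ := h
  refine ⟨?_, ?_, by simp⟩
  · have : A ++ x :: B = (A ++ [x]) ++ B := by simp
    rw [this] at h1
    exact (List.isChain_append.1 h1).1
  · cases A <;> simpa using h2

lemma splice (h : IsPathFrom white u x (A ++ [x])) (h' : IsPathFrom white x v (x :: B)) :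
    IsPathFrom white u v (A ++ x :: B) := by
  obtain ⟨h1, h2, h3⟩ := h
  obtain ⟨h1', h2', h3'⟩ := h'
  refine ⟨?_, ?_, ?_⟩
  · have h1 := List.isChain_append.1 h1
    exact List.isChain_append.2 ⟨h1.1, h1', by simpa using h1.2.2⟩
  · cases A <;> simpa using h2
  · rwa [List.getLast?_append_of_ne_nil _ (by simp)]

lemma cons_cons (h : IsPathFrom white u v (u :: w :: B)) :
    CEdge white u w ∧ IsPathFrom white w v (w :: B) := by
  obtain ⟨h1, h2, h3⟩ := h
  have h1 := List.isChain_cons_cons.1 h1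
  exact ⟨h1.1, h1.2, rfl, by simpa using h3⟩

lemma exists_eq_cons (h : IsPathFrom white u v l) : ∃ t, l = u :: t := by
  obtain ⟨-, h2, -⟩ := h
  cases l with
  | nil => simp at h2
  | cons a t => exact ⟨t, by simpa using h2⟩

/-- Induction along a path that starts at a white square. -/
theorem induction_from_square {motive : Fin m → Fin n → List (CVertex m n) → Prop}
    (nil : ∀ r c, w = .sq r c → motive r c [.sq r c])
    (exit : ∀ r c, w = .col c → white r c = true →
      (∀ i : Fin m, r < i → white i c = false) → motive r c [.sq r c, .col c])
    (left : ∀ r c c' t, c' < c → white r c = true → white r c' = true →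
      (∀ j : Fin n, c' < j → j < c → white r j = false) →
      IsPathFrom white (.sq r c') w (.sq r c' :: t) →
      motive r c' (.sq r c' :: t) → motive r c (.sq r c :: .sq r c' :: t))
    (down : ∀ r r' c t, r < r' → white r c = true → white r' c = true →
      (∀ i : Fin m, r < i → i < r' → white i c = false) →
      IsPathFrom white (.sq r' c) w (.sq r' c :: t) →
      motive r' c (.sq r' c :: t) → motive r c (.sq r c :: .sq r' c :: t)) :
    ∀ (l : List (CVertex m n)) (r : Fin m) (c : Fin n), IsPathFrom white (.sq r c) w l →
      motive r c l := by
  intro l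
  induction l with
  | nil => intro r c h; simpa using h.2.1
  | cons u t ih =>
    intro r c h
    obtain ⟨t', ht'⟩ := h.exists_eq_cons
    obtain ⟨rfl, rfl⟩ := List.cons.inj ht'
    cases t with
    | nil => exact nil r c (by simpa using h.2.2.symm)
    | cons v t =>
      obtain ⟨e, h'⟩ := h.cons_cons
      cases e with
      | toCol _ _ h1 h2 =>
        cases t with
        | nil => exact exit r c (by simpa using h'.2.2.symm) h1 h2
        | cons y t => cases h'.cons_cons.1
      | horiz _ _ _ h1 h2 h3 h4 => exact left _ _ _ _ h1 h2 h3 h4 h' (ih _ _ h')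
      | vert _ _ _ h1 h2 h3 h4 => exact down _ _ _ _ h1 h2 h3 h4 h' (ih _ _ h')

lemma white_of_mem_of_square {i : Fin m} {j : Fin n} {r : Fin m} {c : Fin n}
    (h : IsPathFrom white (.sq r c) w l) (hw : ∀ r c, w ≠ .sq r c) (hm : CVertex.sq i j ∈ l) :
    white i j = true := by
  revert hm
  refine induction_from_square (motive := fun _ _ l => CVertex.sq i j ∈ l → white i j = true)
    ?_ ?_ ?_ ?_ l r c h
  · intro r c h; exact absurd h (hw r c)
  · intro r c _ h1 _ hm
    simp at hm
    rwa [hm.1, hm.2]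
  · intro r c c' t _ h1 _ _ _ ih hm
    rcases List.mem_cons.1 hm with hm | hm
    · cases hm; exact h1
    · exact ih hm
  · intro r r' c t _ h1 _ _ _ ih hm
    rcases List.mem_cons.1 hm with hm | hm
    · cases hm; exact h1
    · exact ih hm

lemma exists_of_row {i : Fin m} (h : IsPathFrom white (.row i) w l) (hw : w ≠ .row i) :
    ∃ k t, l = .row i :: .sq i k :: t ∧ IsPathFrom white (.sq i k) w (.sq i k :: t) := by
  obtain ⟨t, rfl⟩ := h.exists_eq_cons
  cases t with
  | nil => exact absurd (by simpa using h.2.2.symm) hw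
  | cons v t =>
    obtain ⟨e, h'⟩ := h.cons_cons
    cases e
    exact ⟨_, _, rfl, h'⟩

lemma white_of_mem {i : Fin m} {j : Fin n} {r : Fin m} {c : Fin n}
    (h : IsPathFrom white (.row r) (.col c) l) (hm : CVertex.sq i j ∈ l) :
    white i j = true := by
  obtain ⟨k, t, rfl, h'⟩ := h.exists_of_row (by simp)
  exact h'.white_of_mem_of_square (by simp) (by simpa using hm)

end IsPathFrom

end Paths
section Planarity

variable {m n : ℕ} {white : Fin m → Fin n → Bool}

/-- The column in which a path crosses the horizontal line above row `s`: the least column of its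
squares in the rows above row `s`, or `n` if there are none. -/
def cutCol (s : ℕ) (l : List (CVertex m n)) : ℕ :=
  l.foldr (fun v k => if v.rowN < s then min v.colN k else k) n

@[simp] lemma cutCol_nil (s : ℕ) : cutCol s ([] : List (CVertex m n)) = n := rfl

@[simp] lemma cutCol_cons (s : ℕ) (v : CVertex m n) (l : List (CVertex m n)) :
    cutCol s (v :: l) = if v.rowN < s then min v.colN (cutCol s l) else cutCol s l := rfl

lemma cutCol_le_of_mem {s : ℕ} {l : List (CVertex m n)} {v : CVertex m n} (hv : v ∈ l)
    (hs : v.rowN < s) : cutCol s l ≤ v.colN := by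
  induction l with
  | nil => simp at hv
  | cons u t ih =>
    rcases List.mem_cons.1 hv with rfl | hv
    · simp [hs]
    · have := ih hv
      rw [cutCol_cons]
      split <;> omega

lemma le_cutCol {s k : ℕ} {l : List (CVertex m n)} (hk : k ≤ n)
    (h : ∀ v ∈ l, v.rowN < s → k ≤ v.colN) : k ≤ cutCol s l := by
  induction l with
  | nil => simpa using hk
  | cons u t ih =>
    have := ih fun v hv => h v (List.mem_cons_of_mem _ hv)
    have := h u List.mem_cons_self
    rw [cutCol_cons]
    split <;> omega

lemma exists_mem_of_cutCol_lt {s : ℕ} {l : List (CVertex m n)} (h : cutCol s l < n) :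
    ∃ v ∈ l, v.rowN < s ∧ v.colN = cutCol s l := by
  by_contra! hc
  have h1 : cutCol s l + 1 ≤ cutCol s l := le_cutCol h fun v hv hs => by
    have := cutCol_le_of_mem hv hs
    have := hc v hv hs
    omega
  omega

lemma cutCol_cons_of_lt {s : ℕ} {v : CVertex m n} (l : List (CVertex m n)) (h : v.rowN < s) :
    cutCol s (v :: l) = min v.colN (cutCol s l) := by simp [h]

lemma cutCol_cons_of_le {s : ℕ} {v : CVertex m n} (l : List (CVertex m n)) (h : s ≤ v.rowN) :
    cutCol s (v :: l) = cutCol s l := by simp [h]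

lemma cutCol_le (s : ℕ) (l : List (CVertex m n)) : cutCol s l ≤ n := by
  induction l with
  | nil => simp
  | cons u t ih =>
    rw [cutCol_cons]
    split <;> omega

lemma cutCol_antitone {s s' : ℕ} (h : s ≤ s') (l : List (CVertex m n)) :
    cutCol s' l ≤ cutCol s l :=
  le_cutCol (cutCol_le s' l) fun _ hv hs => cutCol_le_of_mem hv (by omega)

namespace IsPathFrom

variable {u w : CVertex m n} {l : List (CVertex m n)}

lemma rowN_le_of_mem {v : CVertex m n} (h : IsPathFrom white u w l) (hv : v ∈ l) :
    u.rowN ≤ v.rowN := by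
  obtain ⟨t, rfl⟩ := h.exists_eq_cons
  rcases List.mem_cons.1 hv with rfl | hv
  · rfl
  · exact ((List.pairwise_cons.1 h.pairwise).1 _ hv).1

lemma colN_le_of_mem {v : CVertex m n} (h : IsPathFrom white u w l) (hv : v ∈ l) :
    v.colN ≤ u.colN := by
  obtain ⟨t, rfl⟩ := h.exists_eq_cons
  rcases List.mem_cons.1 hv with rfl | hv
  · rfl
  · exact ((List.pairwise_cons.1 h.pairwise).1 _ hv).2.1

lemma cutCol_eq_of_le_rowN {s : ℕ} (h : IsPathFrom white u w l) (hs : s ≤ u.rowN) :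
    cutCol s l = n := by
  refine le_antisymm (cutCol_le s l) (le_cutCol le_rfl fun v hv hvs => ?_)
  have := h.rowN_le_of_mem hv
  omega

lemma cutCol_last_of_square {r : Fin m} {c j : Fin n}
    (h : IsPathFrom white (.sq r c) (.col j) l) : cutCol m l = j := by
  refine induction_from_square (motive := fun _ _ l => cutCol m l = j)
    ?_ ?_ ?_ ?_ l r c h
  · simp
  · intro r c h
    cases h
    simp [rowN, colN]
  · intro r c c' t h _ _ _ h' ih
    have := cutCol_le_of_mem (s := m) (l := .sq r c' :: t) List.mem_cons_self (by simp [rowN])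
    rw [cutCol_cons, ih]
    simp only [ih, rowN, colN] at this ⊢
    simp; omega
  · intro r r' c t h _ _ _ h' ih
    have := cutCol_le_of_mem (s := m) (l := .sq r' c :: t) List.mem_cons_self (by simp [rowN])
    rw [cutCol_cons, ih]
    simp only [ih, rowN, colN] at this ⊢
    simp; omega

lemma cutCol_last {i : Fin m} {j : Fin n} (h : IsPathFrom white (.row i) (.col j) l) :
    cutCol m l = j := by
  obtain ⟨k, t, rfl, h'⟩ := h.exists_of_row (by simp)
  have := h'.cutCol_last_of_square
  rw [cutCol_cons, this]
  simp [rowN, colN]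

lemma mem_of_between_of_square {s r : Fin m} {y c j : Fin n}
    (h : IsPathFrom white (.sq r c) (.col j) l) (hw : white s y = true)
    (h1 : cutCol (s + 1) l ≤ y) (h2 : (y : ℕ) ≤ cutCol s l) (h3 : y ≤ c) :
    CVertex.sq s y ∈ l := by
  revert h1 h2 h3
  refine induction_from_square (motive := fun _ c l => cutCol (s + 1) l ≤ y →
    (y : ℕ) ≤ cutCol s l → y ≤ c → CVertex.sq s y ∈ l)
    ?_ ?_ ?_ ?_ l r c h
  · simp
  · intro r c h hr hb h1 h2 h3
    cases h
    simp [rowN, colN] at h1 h2 ⊢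
    have := hb s
    grind
  · intro r c c' t h hr hr' hb h' ih h1 h2 h3
    have e1 := fun hs => cutCol_le_of_mem (s := s + 1) (l := .sq r c' :: t) List.mem_cons_self hs
    have e2 := fun hs => cutCol_le_of_mem (s := s) (l := .sq r c' :: t) List.mem_cons_self hs
    have e3 := h'.cutCol_eq_of_le_rowN (s := s + 1)
    have := hb y
    have f1 := cutCol_cons_of_lt (s := s + 1) (v := .sq r c) (.sq r c' :: t)
    have f2 := cutCol_cons_of_le (s := s + 1) (v := .sq r c) (.sq r c' :: t)
    have f3 := cutCol_cons_of_lt (s := s) (v := .sq r c) (.sq r c' :: t)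
    have f4 := cutCol_cons_of_le (s := s) (v := .sq r c) (.sq r c' :: t)
    simp only [rowN, colN] at e1 e2 e3 f1 f2 f3 f4
    rw [List.mem_cons]
    by_cases hy : s = r ∧ y = c
    · exact Or.inl (by rw [hy.1, hy.2])
    · refine Or.inr (ih ?_ ?_ ?_)
      · omega
      · omega
      · rcases lt_trichotomy s r with hs | hs | hs
        · omega
        · subst hs
          grind
        · omega
  · intro r r' c t h hr hr' hb h' ih h1 h2 h3
    have e1 := fun hs => cutCol_le_of_mem (s := s + 1) (l := .sq r' c :: t) List.mem_cons_self hs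
    have e2 := fun hs => cutCol_le_of_mem (s := s) (l := .sq r' c :: t) List.mem_cons_self hs
    have e3 := h'.cutCol_eq_of_le_rowN (s := s + 1)
    have := hb s
    have f1 := cutCol_cons_of_lt (s := s + 1) (v := .sq r c) (.sq r' c :: t)
    have f2 := cutCol_cons_of_le (s := s + 1) (v := .sq r c) (.sq r' c :: t)
    have f3 := cutCol_cons_of_lt (s := s) (v := .sq r c) (.sq r' c :: t)
    have f4 := cutCol_cons_of_le (s := s) (v := .sq r c) (.sq r' c :: t)
    simp only [rowN, colN] at e1 e2 e3 f1 f2 f3 f4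
    rw [List.mem_cons]
    by_cases hy : s = r ∧ y = c
    · exact Or.inl (by rw [hy.1, hy.2])
    · refine Or.inr (ih ?_ ?_ h3)
      · by_cases hs : s < r'
        · grind
        · omega
      · omega

lemma mem_of_between {s i : Fin m} {y j : Fin n}
    (h : IsPathFrom white (.row i) (.col j) l) (hw : white s y = true)
    (h1 : cutCol (s + 1) l ≤ y) (h2 : (y : ℕ) ≤ cutCol s l) : CVertex.sq s y ∈ l := by
  have hp := h
  obtain ⟨k, t, rfl, h'⟩ := h.exists_of_row (by simp)
  obtain ⟨e, -⟩ := hp.cons_cons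
  have e1 := h'.cutCol_eq_of_le_rowN (s := s + 1)
  have e2 := fun hs => cutCol_le_of_mem (s := s) (l := .sq i k :: t) List.mem_cons_self hs
  have f1 := cutCol_cons_of_lt (s := s + 1) (v := .row i) (.sq i k :: t)
  have f2 := cutCol_cons_of_le (s := s + 1) (v := .row i) (.sq i k :: t)
  have f3 := cutCol_cons_of_lt (s := s) (v := .row i) (.sq i k :: t)
  have f4 := cutCol_cons_of_le (s := s) (v := .row i) (.sq i k :: t)
  simp only [rowN, colN] at e1 e2 f1 f2 f3 f4
  refine List.mem_cons_of_mem _ (h'.mem_of_between_of_square hw ?_ ?_ ?_)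
  · omega
  · omega
  · cases e with
    | fromRow _ _ _ hb =>
      have := hb y
      rcases lt_trichotomy s i with hs | hs | hs
      · omega
      · subst hs
        grind
      · omega

/-- A path crosses the line above row `s` at the column where it crosses the line below, if the
square of row `s` in that column is black. -/
lemma exists_of_black {s i : Fin m} {k j : Fin n}
    (h : IsPathFrom white (.row i) (.col j) l) (hk : cutCol (s + 1) l = k)
    (hb : white s k = false) : cutCol s l = k ∧ ∃ i' < s, white i' k = true := by
  obtain ⟨v, hv, hs, hvk⟩ := exists_mem_of_cutCol_lt (s := s + 1) (l := l) (by omega)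
  rw [hk] at hvk
  cases v with
  | row a => simp [colN] at hvk; omega
  | col a => simp [rowN] at hs; omega
  | sq a b =>
    have hw := h.white_of_mem hv
    simp only [colN, rowN] at hvk hs
    have hb' : b = k := Fin.ext hvk
    subst hb'
    have has : a ≠ s := by rintro rfl; simp_all
    have has' : a < s := by omega
    refine ⟨le_antisymm (cutCol_le_of_mem hv has') ?_, a, has', hw⟩
    rw [← hk]
    exact cutCol_antitone (by omega) l

/-- Two paths without common squares in the rows from `s` on cross the line above row `s` in the
order of their endpoints. -/
theorem cutCol_lt_cutCol (hC : IsCauchon white) {i i' : Fin m} {j j' : Fin n}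
    {l' : List (CVertex m n)} (h : IsPathFrom white (.row i) (.col j) l)
    (h' : IsPathFrom white (.row i') (.col j') l') (hj : j < j') {s : ℕ} (hs : s ≤ m)
    (hd : ∀ a b, s ≤ (a : Fin m).val → CVertex.sq a b ∈ l → CVertex.sq a b ∈ l' → False)
    (hn : cutCol s l' < n) : cutCol s l < cutCol s l' := by
  induction hs using Nat.decreasingInduction with
  | self =>
    rw [h.cutCol_last, h'.cutCol_last]
    exact hj
  | of_succ s hs ih =>
    have a1 := cutCol_antitone (Nat.le_add_right s 1) l
    have a2 := cutCol_antitone (Nat.le_add_right s 1) l'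
    have key := ih (fun a b hab => hd a b (by omega)) (by omega)
    by_contra! hc
    obtain ⟨ka, hka⟩ : ∃ k : Fin n, cutCol (s + 1) l = k :=
      ⟨⟨cutCol (s + 1) l, by omega⟩, rfl⟩
    obtain ⟨kb, hkb⟩ : ∃ k : Fin n, cutCol (s + 1) l' = k :=
      ⟨⟨cutCol (s + 1) l', by omega⟩, rfl⟩
    obtain ⟨t, rfl⟩ : ∃ t : Fin m, s = t := ⟨⟨s, hs⟩, rfl⟩
    cases hwa : white t ka with
    | false =>
      have := (h.exists_of_black hka hwa).1
      omega
    | true =>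
      cases hwb : white t kb with
      | true =>
        exact hd t kb le_rfl (h.mem_of_between hwb (by omega) (by omega))
          (h'.mem_of_between hwb (by omega) (by omega))
      | false =>
        obtain ⟨-, p, hp, hwp⟩ := h'.exists_of_black hkb hwb
        rcases hC t kb hwb with hC | hC
        · simp [hC p hp] at hwp
        · have := hC ka (by omega)
          simp [this] at hwa

end IsPathFrom

end Planarity
section QCommute

/-- `QCommute z e u v`: the elements `u` and `v` commute up to the factor `z ^ e`. -/
def QCommute {G : Type*} [Group G] (z : G) (e : ℤ) (u v : G) : Prop :=
  u * v = z ^ e * (v * u)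

namespace QCommute

variable {G : Type*} [Group G] {z : G} {e e' : ℤ} {u u' v v' : G}

lemma of_eq (h : QCommute z e u v) (he : e = e') : QCommute z e' u v := he ▸ h

lemma zero_iff : QCommute z 0 u v ↔ Commute u v := by
  simp [QCommute, Commute, SemiconjBy]

lemma symm (h : QCommute z e u v) : QCommute z (-e) v u := by
  unfold QCommute at *
  rw [h, zpow_neg, inv_mul_cancel_left]

lemma mul_left (hz : ∀ g, Commute z g) (h : QCommute z e u v) (h' : QCommute z e' u' v) :
    QCommute z (e + e') (u * u') v := by
  unfold QCommute at *
  have hc : u * z ^ e' = z ^ e' * u := ((hz u).zpow_left e').eq.symm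
  calc u * u' * v = u * (u' * v) := mul_assoc _ _ _
    _ = (u * z ^ e') * v * u' := by rw [h']; group
    _ = z ^ e' * (u * v) * u' := by rw [hc]; group
    _ = z ^ (e + e') * (v * (u * u')) := by rw [h, add_comm, zpow_add]; group

lemma inv_left (hz : ∀ g, Commute z g) (h : QCommute z e u v) : QCommute z (-e) u⁻¹ v := by
  unfold QCommute at *
  have hc : u⁻¹ * z ^ e = z ^ e * u⁻¹ := ((hz u⁻¹).zpow_left e).eq.symm
  have : v * u = z ^ (-e) * (u * v) := by rw [h, zpow_neg, inv_mul_cancel_left]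
  have h2 : u⁻¹ * z ^ (-e) = z ^ (-e) * u⁻¹ := ((hz u⁻¹).zpow_left (-e)).eq.symm
  calc u⁻¹ * v = u⁻¹ * (v * u) * u⁻¹ := by group
    _ = (u⁻¹ * z ^ (-e)) * (u * v) * u⁻¹ := by rw [this]; group
    _ = z ^ (-e) * (v * u⁻¹) := by rw [h2]; group

lemma mul_right (hz : ∀ g, Commute z g) (h : QCommute z e u v) (h' : QCommute z e' u v') :
    QCommute z (e + e') u (v * v') :=
  (mul_left hz h.symm h'.symm).symm.of_eq (by ring)

lemma inv_right (hz : ∀ g, Commute z g) (h : QCommute z e u v) : QCommute z (-e) u v⁻¹ :=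
  (inv_left hz h.symm).symm.of_eq (by ring)

end QCommute

end QCommute

namespace QMData

variable {R : Type u} [Ring R] {m n : ℕ} (D : QMData R m n)

lemma commute_q (g : Rˣ) : Commute D.q g :=
  Units.ext (D.q_central g)

/-- The exponent in the commutation relation between `t i j` and `t i' j'`. -/
def exponent (i : Fin m) (j : Fin n) (i' : Fin m) (j' : Fin n) : ℤ :=
  if i = i' then (if j < j' then 1 else if j' < j then -1 else 0)
  else if j = j' then (if i < i' then 1 else -1) else 0

lemma qCommute_t (i : Fin m) (j : Fin n) (i' : Fin m) (j' : Fin n) :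
    QCommute D.q (exponent i j i' j') (D.t i j) (D.t i' j') := by
  have row : ∀ (i : Fin m) {j j' : Fin n}, j < j' → QCommute D.q 1 (D.t i j) (D.t i j') :=
    fun i j j' h => Units.ext (by simpa using D.row_rel i h)
  have col : ∀ {i i' : Fin m} (j : Fin n), i < i' → QCommute D.q 1 (D.t i j) (D.t i' j) :=
    fun j h => Units.ext (by simpa using D.col_rel j h)
  have mix : ∀ {i i' : Fin m} {j j' : Fin n}, i < i' → j ≠ j' →
      QCommute D.q 0 (D.t i j) (D.t i' j') :=
    fun h h' => Units.ext (by simpa using D.mixed_rel h h')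
  unfold exponent
  split_ifs with h1 h2 h3 h4 h5
  · subst h1; exact row i h2
  · subst h1; exact (row i h3).symm
  · subst h1
    obtain rfl : j = j' := by omega
    exact QCommute.zero_iff.2 (Commute.refl _)
  · subst h4; exact col j h5
  · subst h4; exact (col j (by omega)).symm
  · rcases lt_or_gt_of_ne h1 with h | h
    · exact mix h h4
    · exact (mix h (Ne.symm h4)).symm.of_eq neg_zero

/-- The weight of an edge, as a unit. -/
def unitWt : CVertex m n → CVertex m n → Rˣ
  | .row i, .sq i' k => if i = i' then D.t i' k else 1
  | .sq i k, .sq i' j => if i = i' ∧ j < k then (D.t i k)⁻¹ * D.t i j else 1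
  | _, _ => 1

lemma coe_unitWt (u v : CVertex m n) : (D.unitWt u v : R) = wt D u v := by
  cases u <;> cases v <;> simp only [unitWt, wt, Units.val_one] <;> split_ifs <;> simp

/-- The weight of a path, as a unit. -/
def unitPathWeight (l : List (CVertex m n)) : Rˣ :=
  ((steps l).map fun p => D.unitWt p.1 p.2).prod

lemma coe_unitPathWeight (l : List (CVertex m n)) :
    (D.unitPathWeight l : R) = pathWeight D l := by
  rw [unitPathWeight, pathWeight, ← Units.coeHom_apply, map_list_prod, List.map_map]
  congr 2
  ext p
  simp [coe_unitWt]

@[simp] lemma unitPathWeight_singleton (u : CVertex m n) : D.unitPathWeight [u] = 1 := by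
  simp [unitPathWeight, steps]

lemma unitPathWeight_cons_cons (u v : CVertex m n) (l : List (CVertex m n)) :
    D.unitPathWeight (u :: v :: l) = D.unitWt u v * D.unitPathWeight (v :: l) := by
  simp [unitPathWeight, steps]

lemma unitPathWeight_append (A B : List (CVertex m n)) (x : CVertex m n) :
    D.unitPathWeight (A ++ x :: B) =
      D.unitPathWeight (A ++ [x]) * D.unitPathWeight (x :: B) := by
  induction A with
  | nil => simp
  | cons u A ih =>
    cases A with
    | nil => simp [unitPathWeight_cons_cons]
    | cons v A =>
      simp only [List.cons_append] at ih ⊢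
      rw [unitPathWeight_cons_cons, unitPathWeight_cons_cons, ih, mul_assoc]

/-- The weight of a path from the square `(r, c)`, times `t r c` on the left: the weight that the
path has when it enters the square from a row vertex. -/
def fromSquare (r : Fin m) (c : Fin n) (l : List (CVertex m n)) : Rˣ :=
  D.t r c * D.unitPathWeight l

lemma fromSquare_singleton (r : Fin m) (c : Fin n) : D.fromSquare r c [.sq r c] = D.t r c := by
  simp [fromSquare]

lemma fromSquare_exit (r : Fin m) (c : Fin n) :
    D.fromSquare r c [.sq r c, .col c] = D.t r c := by
  simp [fromSquare, unitPathWeight_cons_cons, unitWt]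

lemma fromSquare_left {r : Fin m} {c c' : Fin n} (h : c' < c) (t : List (CVertex m n)) :
    D.fromSquare r c (.sq r c :: .sq r c' :: t) = D.fromSquare r c' (.sq r c' :: t) := by
  simp [fromSquare, unitPathWeight_cons_cons, unitWt, h, mul_assoc]

lemma fromSquare_down {r r' : Fin m} {c : Fin n} (t : List (CVertex m n)) :
    D.fromSquare r c (.sq r c :: .sq r' c :: t) =
      D.t r c * (D.t r' c)⁻¹ * D.fromSquare r' c (.sq r' c :: t) := by
  simp [fromSquare, unitPathWeight_cons_cons, unitWt, mul_assoc]

lemma unitPathWeight_row (i : Fin m) (k : Fin n) (t : List (CVertex m n)) :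
    D.unitPathWeight (.row i :: .sq i k :: t) = D.fromSquare i k (.sq i k :: t) := by
  simp [fromSquare, unitPathWeight_cons_cons, unitWt]

variable {D} {white : Fin m → Fin n → Bool} {l : List (CVertex m n)}

open IsPathFrom

lemma qCommute_fromSquare_of_forall {w : CVertex m n} {g : Rˣ} (f : ℕ → ℤ) (f' : Fin m → ℤ)
    {r : Fin m} {c : Fin n} (h : IsPathFrom white (.sq r c) w l)
    (hg : ∀ i j, CVertex.sq i j ∈ l → QCommute D.q (f j + f' i) (D.t i j) g) :
    QCommute D.q (f w.colN + f' r) (D.fromSquare r c l) g := by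
  revert hg
  have hz := D.commute_q
  refine induction_from_square (motive := fun r c l =>
    (∀ i j, CVertex.sq i j ∈ l → QCommute D.q (f j + f' i) (D.t i j) g) →
    QCommute D.q (f w.colN + f' r) (D.fromSquare r c l) g) ?_ ?_ ?_ ?_ l r c h
  · rintro r c rfl hg
    rw [fromSquare_singleton]
    exact hg _ _ (by simp)
  · rintro r c rfl _ _ hg
    rw [fromSquare_exit]
    exact hg _ _ (by simp)
  · intro r c c' t hc _ _ _ _ ih hg
    rw [fromSquare_left _ hc]
    exact ih fun i j hm => hg i j (List.mem_cons_of_mem _ hm)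
  · intro r r' c t hr _ _ _ _ ih hg
    rw [fromSquare_down]
    exact (((hg r c (by simp)).mul_left hz ((hg r' c (by simp)).inv_left hz)).mul_left hz
      (ih fun i j hm => hg i j (List.mem_cons_of_mem _ hm))).of_eq (by ring)

lemma qCommute_path_of_forall {w : CVertex m n} {g : Rˣ} (f : ℕ → ℤ)
    {r : Fin m} (h : IsPathFrom white (.row r) w l) (hw : w ≠ .row r)
    (hg : ∀ i j, CVertex.sq i j ∈ l → QCommute D.q (f j) (D.t i j) g) :
    QCommute D.q (f w.colN) (D.unitPathWeight l) g := by
  obtain ⟨k, t, rfl, h'⟩ := h.exists_of_row hw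
  rw [unitPathWeight_row]
  simpa using qCommute_fromSquare_of_forall f (fun _ => 0) h' fun i j hm => by
    simpa using hg i j (List.mem_cons_of_mem _ hm)

/-- The commutation relation between a generator of a white square and a path weight. -/
lemma qCommute_t_fromSquare {r i : Fin m} {c j y : Fin n}
    (h : IsPathFrom white (.sq r c) (.col j) l) (hw : white i y = true) :
    QCommute D.q ((if CVertex.sq i y ∈ l then -2 else 0) + (if y = j then 1 else 0) +
      (if i = r then (if y ≤ c then 1 else -1) else 0)) (D.t i y) (D.fromSquare r c l) := by
  have hz := D.commute_q
  refine induction_from_square (motive := fun r c l =>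
    QCommute D.q ((if CVertex.sq i y ∈ l then -2 else 0) + (if y = j then 1 else 0) +
      (if i = r then (if y ≤ c then 1 else -1) else 0)) (D.t i y) (D.fromSquare r c l))
    ?_ ?_ ?_ ?_ l r c h
  · simp
  · rintro r c h _ hb
    cases h
    rw [fromSquare_exit]
    refine (D.qCommute_t i y r j).of_eq ?_
    have := hb i
    unfold exponent
    simp
    grind
  · intro r c c' t hc _ _ hb h' ih
    rw [fromSquare_left _ hc]
    refine ih.of_eq ?_
    have := hb y
    have hn : CVertex.sq r c ∉ CVertex.sq r c' :: t := fun hm => by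
      have := h'.colN_le_of_mem hm
      simp [colN] at this
      omega
    have hm : CVertex.sq i y ∈ CVertex.sq r c :: CVertex.sq r c' :: t ↔
        (i = r ∧ y = c) ∨ CVertex.sq i y ∈ CVertex.sq r c' :: t := by
      rw [List.mem_cons, CVertex.sq.injEq]
    have hn' : i = r → y = c → CVertex.sq i y ∉ CVertex.sq r c' :: t := by
      rintro rfl rfl; exact hn
    simp only [hm]
    clear hm hn
    by_cases hp : CVertex.sq i y ∈ CVertex.sq r c' :: t
    · simp only [hp, or_true, if_true]
      grind
    · simp only [hp, or_false, if_false]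
      grind
  · intro r r' c t hr _ _ hb h' ih
    rw [fromSquare_down]
    refine (((D.qCommute_t i y r c).mul_right hz ((D.qCommute_t i y r' c).inv_right hz)).mul_right
      hz ih).of_eq ?_
    have := hb i
    have hn : CVertex.sq r c ∉ CVertex.sq r' c :: t := fun hm => by
      have := h'.rowN_le_of_mem hm
      simp [rowN] at this
      omega
    have hm : CVertex.sq i y ∈ CVertex.sq r c :: CVertex.sq r' c :: t ↔
        (i = r ∧ y = c) ∨ CVertex.sq i y ∈ CVertex.sq r' c :: t := by
      rw [List.mem_cons, CVertex.sq.injEq]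
    have hn' : i = r → y = c → CVertex.sq i y ∉ CVertex.sq r' c :: t := by
      rintro rfl rfl; exact hn
    simp only [hm]
    clear hm hn
    unfold exponent
    by_cases hp : CVertex.sq i y ∈ CVertex.sq r' c :: t
    · simp only [hp, or_true, if_true]
      grind
    · simp only [hp, or_false, if_false]
      grind

end QMData

section TailSwap

variable {m n : ℕ} {white : Fin m → Fin n → Bool} {k : ℕ} {ι : Fin k → Fin m} {κ : Fin k → Fin n}

namespace IsPathFrom

variable {u v x y : CVertex m n} {A B : List (CVertex m n)}

lemma precedes_of_mem_left (h : IsPathFrom white u v (A ++ x :: B)) (hy : y ∈ A) :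
    Precedes y x :=
  (List.pairwise_append.1 h.pairwise).2.2 y hy x List.mem_cons_self

lemma precedes_of_mem_right (h : IsPathFrom white u v (A ++ x :: B)) (hy : y ∈ B) :
    Precedes x y :=
  (List.pairwise_cons.1 (List.pairwise_append.1 h.pairwise).2.1).1 y hy

lemma notMem_left (h : IsPathFrom white u v (A ++ x :: B)) : x ∉ A := fun hx =>
  later_irrefl x (h.precedes_of_mem_left hx).2.2

end IsPathFrom

lemma append_cons_inj_of_notMem {α : Type*} {x : α} {A A' B B' : List α} (h : x ∉ A)
    (h' : x ∉ A') (e : A ++ x :: B = A' ++ x :: B') : A = A' ∧ B = B' := by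
  induction A generalizing A' with
  | nil =>
    cases A' with
    | nil => simpa using e
    | cons a' A' => exact absurd ((List.cons.inj e).1 ▸ List.mem_cons_self) h'
  | cons a A ih =>
    cases A' with
    | nil => exact absurd ((List.cons.inj e).1 ▸ List.mem_cons_self) h
    | cons a' A' =>
      simp only [List.cons_append, List.cons.injEq, List.mem_cons, not_or] at e h h'
      have := ih h.2 h'.2 e.2
      exact ⟨by rw [e.1, this.1], this.2⟩

/-- `S'` arises from `S` by exchanging the tails of the paths `a` and `b` after their common
square `(r, c)`, the last vertex shared by two paths of `S`; the path `a` of `S` leaves this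
square to the left, towards `(r, c')`. -/
structure IsTailSwap (S S' : PathSys white ι κ) (a b : Fin k) (r : Fin m) (c c' : Fin n)
    (A B A' B' : List (CVertex m n)) : Prop where
  ne : a ≠ b
  left : S.P a = A ++ .sq r c :: .sq r c' :: B
  down : S.P b = A' ++ .sq r c :: B'
  last : ∀ y d d', Later (.sq r c) y → y ∈ S.P d → y ∈ S.P d' → d = d'
  left' : S'.P a = A ++ .sq r c :: B'
  down' : S'.P b = A' ++ .sq r c :: .sq r c' :: B
  others : ∀ d, d ≠ a → d ≠ b → S'.P d = S.P d
  perm : S'.σ = S.σ * Equiv.swap a b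

namespace IsTailSwap

variable {S S' : PathSys white ι κ} {a b : Fin k} {r : Fin m} {c c' : Fin n}
  {A B A' B' : List (CVertex m n)}

lemma path_left (h : IsTailSwap S S' a b r c c' A B A' B') :
    IsPathFrom white (.row (ι a)) (.col (κ (S.σ a))) (A ++ .sq r c :: .sq r c' :: B) :=
  h.left ▸ S.isPath a

lemma path_down (h : IsTailSwap S S' a b r c c' A B A' B') :
    IsPathFrom white (.row (ι b)) (.col (κ (S.σ b))) (A' ++ .sq r c :: B') :=
  h.down ▸ S.isPath b

lemma lt (h : IsTailSwap S S' a b r c c' A B A' B') : c' < c := by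
  obtain ⟨e, -⟩ := h.path_left.suffix.cons_cons
  cases e <;> omega

lemma mem_iff (h : IsTailSwap S S' a b r c c' A B A' B') {y : CVertex m n}
    (hy : Later (.sq r c) y) (d : Fin k) : y ∈ S'.P d ↔ y ∈ S.P (Equiv.swap a b d) := by
  have hA : y ∉ A := fun hm => by
    have := (h.path_left.precedes_of_mem_left hm).2.2
    unfold Later at *; omega
  have hA' : y ∉ A' := fun hm => by
    have := (h.path_down.precedes_of_mem_left hm).2.2
    unfold Later at *; omega
  by_cases hda : d = a
  · subst hda
    simp [h.left', h.down, hA, hA']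
  by_cases hdb : d = b
  · subst hdb
    simp [h.down', h.left, hA, hA']
  · rw [Equiv.swap_apply_of_ne_of_ne hda hdb, h.others d hda hdb]

lemma symm (h : IsTailSwap S S' a b r c c' A B A' B') :
    IsTailSwap S' S b a r c c' A' B A B' where
  ne := h.ne.symm
  left := h.down'
  down := h.left'
  last y d d' hy hd hd' :=
    (Equiv.swap a b).injective (h.last y _ _ hy ((h.mem_iff hy d).1 hd) ((h.mem_iff hy d').1 hd'))
  left' := h.down
  down' := h.left
  others d hb ha := (h.others d ha hb).symm
  perm := by rw [h.perm, Equiv.swap_comm b a, mul_assoc, Equiv.swap_mul_self, mul_one]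

lemma not_vertexDisjoint (h : IsTailSwap S S' a b r c c' A B A' B') : ¬ S.VertexDisjoint :=
  fun hd => hd a b h.ne (.sq r c) (by simp [h.left]) (by simp [h.down])

lemma ne_systems (h : IsTailSwap S S' a b r c c' A B A' B') : S' ≠ S := by
  rintro rfl
  have := h.perm
  rw [left_eq_mul, Equiv.swap_eq_one_iff] at this
  exact h.ne this

/-- The path `b` leaves the square `(r, c)` downwards. -/
lemma exists_down (h : IsTailSwap S S' a b r c c' A B A' B') :
    ∃ v t, B' = v :: t ∧ CEdge white (.sq r c) v ∧ v.colN = c ∧ r < v.rowN := by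
  have hb := h.path_down.suffix
  cases B' with
  | nil => exact absurd hb.2.2 (by simp)
  | cons v t =>
    obtain ⟨e, -⟩ := hb.cons_cons
    refine ⟨v, t, rfl, e, ?_⟩
    have h1 := h.path_left.suffix.cons_cons.1
    cases e with
    | toCol => simp [colN, rowN]
    | vert _ i' => simpa [colN, rowN]
    | horiz _ _ j h2 h3 h4 h5 =>
      have := h.lt
      obtain rfl : j = c' := by
        cases h1 with
        | horiz _ _ _ _ _ h4' h5' =>
          have := h5 c'
          have := h5' j
          grind
        | vert => omega
      refine absurd (h.last (.sq r j) a b ?_ (by simp [h.left]) (by simp [h.down])) h.ne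
      simp [Later, rowN, colN, h2]

lemma mem_or_mem_of_mem (h : IsTailSwap S S' a b r c c' A B A' B') {d : Fin k}
    (hd : CVertex.sq r c ∈ S.P d) : d = a ∨ d = b := by
  obtain ⟨v, t, rfl, e, hv⟩ := h.exists_down
  obtain ⟨X, Y, hXY⟩ := List.append_of_mem hd
  have hp := (hXY ▸ S.isPath d).suffix
  cases Y with
  | nil => exact absurd hp.2.2 (by simp)
  | cons w Y =>
    obtain ⟨e', -⟩ := hp.cons_cons
    have h1 := h.path_left.suffix.cons_cons.1
    have hw : w = .sq r c' ∨ w = v := by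
      cases h1 with
      | vert => omega
      | horiz _ _ _ _ _ h2 h3 =>
      cases e' with
      | toCol _ _ _ h4 =>
        cases e with
        | toCol => simp
        | vert _ i => have := h4 i; grind
        | horiz => simp [rowN] at hv
      | vert _ i' _ _ _ _ h4 =>
        cases e with
        | toCol _ _ _ h5 => have := h5 i'; grind
        | vert _ i _ _ _ _ h5 =>
          have := h5 i'
          have := h4 i
          grind
        | horiz => simp [rowN] at hv
      | horiz _ _ j _ _ _ h4 =>
        have := h3 j
        have := h4 c'
        grind
    rcases hw with rfl | rfl
    · exact Or.inl (h.last _ d a e'.later (by simp [hXY]) (by simp [h.left]))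
    · exact Or.inr (h.last _ d b e'.later (by simp [hXY]) (by simp [h.down]))

end IsTailSwap

/-- Two path systems related by exchanging the tails of two paths at the last shared square. -/
def TailSwapped (S S' : PathSys white ι κ) : Prop :=
  ∃ a b r c c' A B A' B', IsTailSwap S S' a b r c c' A B A' B'

lemma TailSwapped.symm {S S' : PathSys white ι κ} (h : TailSwapped S S') : TailSwapped S' S := by
  obtain ⟨a, b, r, c, c', A, B, A', B', h⟩ := h
  exact ⟨b, a, r, c, c', A', B, A, B', h.symm⟩

lemma TailSwapped.not_vertexDisjoint {S S' : PathSys white ι κ} (h : TailSwapped S S') :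
    ¬ S.VertexDisjoint := by
  obtain ⟨a, b, r, c, c', A, B, A', B', h⟩ := h
  exact h.not_vertexDisjoint

lemma TailSwapped.ne {S S' : PathSys white ι κ} (h : TailSwapped S S') : S' ≠ S := by
  obtain ⟨a, b, r, c, c', A, B, A', B', h⟩ := h
  exact h.ne_systems

lemma TailSwapped.unique {S S₁ S₂ : PathSys white ι κ} (h₁ : TailSwapped S S₁)
    (h₂ : TailSwapped S S₂) : S₁ = S₂ := by
  obtain ⟨a, b, r, c, c', A, B, A', B', h⟩ := h₁
  obtain ⟨a₂, b₂, r₂, c₂, c₂', A₂, B₂, A₂', B₂', h'⟩ := h₂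
  have hx : CVertex.sq r c = .sq r₂ c₂ := by
    rcases later_trichotomy (CVertex.sq r c) (.sq r₂ c₂) with hl | hl | hl
    · exact absurd (h.last _ a₂ b₂ hl (by simp [h'.left]) (by simp [h'.down])) h'.ne
    · exact hl
    · exact absurd (h'.last _ a b hl (by simp [h.left]) (by simp [h.down])) h.ne
  cases hx
  have hab : a₂ = a ∧ b₂ = b := by
    have ha := h.mem_or_mem_of_mem (d := a₂) (by simp [h'.left])
    have hb := h.mem_or_mem_of_mem (d := b₂) (by simp [h'.down])
    have hne := h'.ne
    rcases ha with rfl | rfl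
    · exact ⟨rfl, hb.resolve_left (Ne.symm hne)⟩
    · have hd := h.path_down.notMem_left
      have hl := h'.path_left.notMem_left
      obtain ⟨v, t, rfl, -, hv⟩ := h.exists_down
      have := (append_cons_inj_of_notMem hl hd (h'.left.symm.trans h.down)).2
      simp only [List.cons.injEq] at this
      rw [← this.1] at hv
      simp [rowN] at hv
  obtain ⟨rfl, rfl⟩ := hab
  obtain ⟨rfl, e⟩ := append_cons_inj_of_notMem h.path_left.notMem_left h'.path_left.notMem_left
    (h.left.symm.trans h'.left)
  obtain ⟨rfl, rfl⟩ := append_cons_inj_of_notMem h.path_down.notMem_left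
    h'.path_down.notMem_left (h.down.symm.trans h'.down)
  obtain ⟨e', rfl⟩ := List.cons.inj e
  cases e'
  have hσ : S₁.σ = S₂.σ := by rw [h.perm, h'.perm]
  have hP : S₁.P = S₂.P := by
    ext1 d
    by_cases hda : d = a₂
    · rw [hda, h.left', h'.left']
    by_cases hdb : d = b₂
    · rw [hdb, h.down', h'.down']
    · rw [h.others d hda hdb, h'.others d hda hdb]
  cases S₁
  cases S₂
  cases hσ
  cases hP
  rfl

lemma exists_isTailSwap {S : PathSys white ι κ} {a b : Fin k} {r : Fin m} {c c' : Fin n}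
    {A B A' B' : List (CVertex m n)} (ne : a ≠ b)
    (left : S.P a = A ++ .sq r c :: .sq r c' :: B) (down : S.P b = A' ++ .sq r c :: B')
    (last : ∀ y d d', Later (.sq r c) y → y ∈ S.P d → y ∈ S.P d' → d = d') :
    ∃ S', IsTailSwap S S' a b r c c' A B A' B' := by
  have ha := S.isPath a
  have hb := S.isPath b
  rw [left] at ha
  rw [down] at hb
  refine ⟨⟨S.σ * Equiv.swap a b, fun d => if d = a then A ++ .sq r c :: B' else
    if d = b then A' ++ .sq r c :: .sq r c' :: B else S.P d, fun d => ?_⟩, ⟨ne, left, down, last,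
    by simp, by simp [ne.symm], fun d hda hdb => by simp [hda, hdb], rfl⟩⟩
  split_ifs with hda hdb
  · subst hda
    simpa using ha.before.splice hb.suffix
  · subst hdb
    simpa using hb.before.splice ha.suffix
  · simpa [Equiv.swap_apply_of_ne_of_ne hda hdb] using S.isPath d

lemma exists_last_shared {S : PathSys white ι κ} (hS : ¬ S.VertexDisjoint) :
    ∃ a b x, a ≠ b ∧ x ∈ S.P a ∧ x ∈ S.P b ∧
      ∀ y d d', Later x y → y ∈ S.P d → y ∈ S.P d' → d = d' := by
  classical
  simp only [PathSys.VertexDisjoint, not_forall, exists_prop, not_false_eq_true, and_true] at hS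
  obtain ⟨a, b, hab, x, ha, hb⟩ := hS
  let p : ℕ → Prop := fun N => ∃ a b x, a ≠ b ∧ x ∈ S.P a ∧ x ∈ S.P b ∧ x.key = N
  have hp : p x.key := ⟨a, b, x, hab, ha, hb, rfl⟩
  obtain ⟨a, b, x, hab, ha, hb, hx⟩ := Nat.findGreatest_spec x.key_le hp
  refine ⟨a, b, x, hab, ha, hb, fun y d d' hy hd hd' => by_contra fun hne => ?_⟩
  have h1 := key_lt_key hy
  have h2 := Nat.le_findGreatest y.key_le (show p y.key from ⟨d, d', y, hne, hd, hd', rfl⟩)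
  omega

lemma IsPathFrom.eq_of_row_mem {i i' : Fin m} {j : Fin n} {l : List (CVertex m n)}
    (h : IsPathFrom white (.row i) (.col j) l) (hm : CVertex.row i' ∈ l) : i' = i := by
  obtain ⟨y, t, rfl, h'⟩ := h.exists_of_row (by simp)
  rcases List.mem_cons.1 hm with hm | hm
  · simpa using hm
  · have := h'.colN_le_of_mem hm
    simp [colN] at this
    omega

lemma IsPathFrom.eq_of_col_mem {u : CVertex m n} {j j' : Fin n} {l : List (CVertex m n)}
    (h : IsPathFrom white u (.col j) l) (hm : CVertex.col j' ∈ l) : j' = j := by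
  obtain ⟨X, Y, rfl⟩ := List.append_of_mem hm
  have h' := h.suffix
  cases Y with
  | nil => simpa using h'.2.2
  | cons w Y => cases h'.cons_cons.1

lemma exists_tailSwapped (hι : StrictMono ι) (hκ : StrictMono κ) {S : PathSys white ι κ}
    (hS : ¬ S.VertexDisjoint) : ∃ S', TailSwapped S S' := by
  obtain ⟨a, b, x, hab, ha, hb, hl⟩ := exists_last_shared hS
  cases x with
  | row i =>
    exact absurd (hι.injective (((S.isPath a).eq_of_row_mem ha).symm.trans
      ((S.isPath b).eq_of_row_mem hb))) hab
  | col j =>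
    exact absurd (S.σ.injective (hκ.injective (((S.isPath a).eq_of_col_mem ha).symm.trans
      ((S.isPath b).eq_of_col_mem hb)))) hab
  | sq r c =>
    obtain ⟨A, Y, hY⟩ := List.append_of_mem ha
    obtain ⟨A', Y', hY'⟩ := List.append_of_mem hb
    have hpa := (hY ▸ S.isPath a).suffix
    have hpb := (hY' ▸ S.isPath b).suffix
    cases Y with
    | nil => exact absurd hpa.2.2 (by simp)
    | cons v Y =>
    cases Y' with
    | nil => exact absurd hpb.2.2 (by simp)
    | cons v' Y' =>
    by_cases h1 : ∃ c', v = .sq r c'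
    · obtain ⟨c', rfl⟩ := h1
      obtain ⟨S', h⟩ := exists_isTailSwap hab hY hY' hl
      exact ⟨S', _, _, _, _, _, _, _, _, _, h⟩
    by_cases h2 : ∃ c', v' = .sq r c'
    · obtain ⟨c', rfl⟩ := h2
      obtain ⟨S', h⟩ := exists_isTailSwap hab.symm hY' hY hl
      exact ⟨S', _, _, _, _, _, _, _, _, _, h⟩
    exfalso
    have e := hpa.cons_cons.1
    have e' := hpb.cons_cons.1
    have hv : v = v' := by
      cases e with
      | horiz => exact absurd ⟨_, rfl⟩ h1
      | toCol _ _ _ h4 =>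
        cases e' with
        | toCol => rfl
        | vert _ i => have := h4 i; grind
        | horiz => exact absurd ⟨_, rfl⟩ h2
      | vert _ i' _ _ _ _ h4 =>
        cases e' with
        | toCol _ _ _ h5 => have := h5 i'; grind
        | vert _ i _ _ _ _ h5 =>
          have := h5 i'
          have := h4 i
          grind
        | horiz => exact absurd ⟨_, rfl⟩ h2
    subst hv
    exact hab (hl v a b e.later (by simp [hY]) (by simp [hY']))

end TailSwap

namespace IsTailSwap

variable {m n : ℕ} {white : Fin m → Fin n → Bool} {k : ℕ} {ι : Fin k → Fin m} {κ : Fin k → Fin n}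
  {S S' : PathSys white ι κ} {a b : Fin k} {r : Fin m} {c c' : Fin n}
  {A B A' B' : List (CVertex m n)}

lemma cutCol_down (h : IsTailSwap S S' a b r c c' A B A' B') :
    cutCol (r + 1) (S.P b) = c := by
  refine le_antisymm (cutCol_le_of_mem (v := .sq r c) (by simp [h.down]) (by simp [rowN])) ?_
  refine le_cutCol c.2.le fun v hv hvr => ?_
  have hp := h.path_down
  rw [h.down] at hv
  rcases List.mem_append.1 hv with hv | hv
  · exact (hp.precedes_of_mem_left hv).2.1
  rcases List.mem_cons.1 hv with rfl | hv
  · rfl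
  obtain ⟨w, t, rfl, -, hw⟩ := h.exists_down
  have hp' := (hp.suffix.cons_cons.2).rowN_le_of_mem hv
  omega

lemma le_cutCol_left (h : IsTailSwap S S' a b r c c' A B A' B') :
    c ≤ cutCol r (S.P a) := by
  refine le_cutCol c.2.le fun v hv hvr => ?_
  have hp := h.path_left
  rw [h.left] at hv
  rcases List.mem_append.1 hv with hv | hv
  · exact (hp.precedes_of_mem_left hv).2.1
  · have := hp.suffix.rowN_le_of_mem hv
    simp [rowN] at this hvr
    omega

/-- The two paths exchanged by a tail swap end at neighbouring sinks of the system. -/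
theorem perm_apply_eq_succ (hC : IsCauchon white) (hκ : StrictMono κ)
    (h : IsTailSwap S S' a b r c c' A B A' B') : (S.σ b).val = (S.σ a).val + 1 := by
  have hd : ∀ d d' : Fin k, d ≠ d' → ∀ i y, r.val + 1 ≤ (i : Fin m).val →
      CVertex.sq i y ∈ S.P d → CVertex.sq i y ∈ S.P d' → False := fun d d' hne i y hi h1 h2 =>
    hne (h.last _ d d' (Or.inl (by simpa [rowN] using hi)) h1 h2)
  have hr : r.val + 1 ≤ m := r.2
  have hb := h.cutCol_down
  have ha : cutCol (r + 1) (S.P a) ≤ c' :=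
    cutCol_le_of_mem (v := .sq r c') (by simp [h.left]) (by simp [rowN])
  have hc := h.lt
  have hlt : S.σ a < S.σ b := by
    refine lt_of_not_ge fun hle => ?_
    have := IsPathFrom.cutCol_lt_cutCol hC (S.isPath b) (S.isPath a)
      (hκ (lt_of_le_of_ne hle (S.σ.injective.ne h.ne.symm))) hr (hd b a h.ne.symm) (by omega)
    omega
  by_contra hne
  obtain ⟨d, hσd⟩ := S.σ.surjective ⟨(S.σ a).val + 1, by omega⟩
  have had : S.σ a < S.σ d := by rw [hσd, Fin.lt_def]; simp
  have hdb : S.σ d < S.σ b := by rw [hσd, Fin.lt_def]; simp; omega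
  have hda : d ≠ a := by rintro rfl; exact lt_irrefl _ had
  have hdb' : d ≠ b := by rintro rfl; exact lt_irrefl _ hdb
  have h1 := IsPathFrom.cutCol_lt_cutCol hC (S.isPath d) (S.isPath b) (hκ hdb) hr (hd d b hdb')
    (by omega)
  have h2 := IsPathFrom.cutCol_lt_cutCol hC (S.isPath a) (S.isPath d) (hκ had) hr (hd a d hda.symm)
    (by omega)
  have h3 := h.le_cutCol_left
  have h4 : cutCol (r + 1) (S.P d) < n := by omega
  obtain ⟨y, hy⟩ : ∃ y : Fin n, y.val = cutCol (r + 1) (S.P d) := ⟨⟨_, h4⟩, rfl⟩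
  by_cases hw : white r y
  · have m1 := (S.isPath d).mem_of_between hw hy.ge
      (hy.le.trans (cutCol_antitone (Nat.le_succ _) _))
    have m2 := (S.isPath a).mem_of_between hw (by omega) (by omega)
    exact hda (h.last (.sq r y) d a (Or.inr ⟨rfl, by simp [colN]; omega⟩) m1 m2)
  · rw [Bool.not_eq_true] at hw
    obtain ⟨-, i', hi', hwi'⟩ := (S.isPath d).exists_of_black hy.symm hw
    obtain ⟨v, hv, hvr, hvc⟩ := exists_mem_of_cutCol_lt (s := r + 1) (l := S.P a) (by omega)
    have hvr' : v.rowN = r := by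
      by_contra hvr'
      have := cutCol_le_of_mem (s := r) hv (by omega)
      omega
    cases v with
    | row => simp [colN] at hvc; omega
    | col => simp [rowN] at hvr'; omega
    | sq i j =>
      obtain rfl : i = r := Fin.ext hvr'
      have hwj := (S.isPath a).white_of_mem hv
      simp only [colN] at hvc
      rcases hC _ _ hw with hC | hC
      · simp [hC i' hi'] at hwi'
      · simp [hC j (by omega)] at hwj

end IsTailSwap

namespace IsTailSwap

variable {R : Type u} [Ring R] {m n : ℕ} {D : QMData R m n} {white : Fin m → Fin n → Bool} {k : ℕ}
  {ι : Fin k → Fin m} {κ : Fin k → Fin n} {S S' : PathSys white ι κ} {a b : Fin k} {r : Fin m}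
  {c c' : Fin n} {A B A' B' : List (CVertex m n)}

lemma notMem_of_mem_left (h : IsTailSwap S S' a b r c c' A B A' B') {y : CVertex m n}
    (hy : y ∈ CVertex.sq r c' :: B) : y ∉ .sq r c :: B' := by
  have hl := (h.path_left.precedes_of_mem_right hy).2.2
  intro hm
  rcases List.mem_cons.1 hm with rfl | hm
  · exact later_irrefl _ hl
  · exact h.ne (h.last y a b hl (by rw [h.left]; simp_all) (by simp [h.down, hm]))

/-- The tails of the two exchanged paths commute up to one factor `q`. -/
lemma qCommute_tails (h : IsTailSwap S S' a b r c c' A B A' B') (hκ : StrictMono κ) :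
    QCommute D.q 1 (D.fromSquare r c (.sq r c :: .sq r c' :: B))
      (D.fromSquare r c (.sq r c :: B')) := by
  have hj : κ (S.σ a) ≠ κ (S.σ b) := hκ.injective.ne (S.σ.injective.ne h.ne)
  have hc := h.lt
  have hp := h.path_left.suffix.cons_cons.2
  rw [D.fromSquare_left hc]
  refine (QMData.qCommute_fromSquare_of_forall (fun y => if y = (κ (S.σ b)).val then 1 else 0)
    (fun i => if i = r then 1 else 0) hp fun i y hm => ?_).of_eq (by simp [colN, Fin.val_inj, hj])
  refine (QMData.qCommute_t_fromSquare h.path_down.suffix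
    (hp.white_of_mem_of_square (by simp) hm)).of_eq ?_
  have hy : y ≤ c := by
    have := hp.colN_le_of_mem hm
    simp only [colN] at this
    omega
  simp [h.notMem_of_mem_left hm, hy, Fin.val_inj]

lemma qCommute_t_quotient (h : IsTailSwap S S' a b r c c' A B A' B') {i : Fin m} {y : Fin n}
    (hw : white i y = true)
    (hm : CVertex.sq i y ∈ CVertex.sq r c :: .sq r c' :: B ↔ .sq i y ∈ CVertex.sq r c :: B') :
    QCommute D.q ((if y = κ (S.σ a) then 1 else 0) - if y = κ (S.σ b) then 1 else 0) (D.t i y)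
      (D.fromSquare r c (.sq r c :: .sq r c' :: B) * (D.fromSquare r c (.sq r c :: B'))⁻¹) := by
  have hz := D.commute_q
  refine ((QMData.qCommute_t_fromSquare h.path_left.suffix hw).mul_right hz
    ((QMData.qCommute_t_fromSquare h.path_down.suffix hw).inv_right hz)).of_eq ?_
  simp only [hm]
  ring

lemma commute_of_ne (h : IsTailSwap S S' a b r c c' A B A' B') (hκ : StrictMono κ) {d : Fin k}
    (hda : d ≠ a) (hdb : d ≠ b) :
    Commute (D.unitPathWeight (S.P d)) (D.fromSquare r c (.sq r c :: .sq r c' :: B) *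
      (D.fromSquare r c (.sq r c :: B'))⁻¹) := by
  have ha : κ (S.σ d) ≠ κ (S.σ a) := hκ.injective.ne (S.σ.injective.ne hda)
  have hb : κ (S.σ d) ≠ κ (S.σ b) := hκ.injective.ne (S.σ.injective.ne hdb)
  refine QCommute.zero_iff.1 ((QMData.qCommute_path_of_forall
    (fun y => (if y = (κ (S.σ a)).val then 1 else 0) - if y = (κ (S.σ b)).val then 1 else 0)
    (S.isPath d) (by simp) fun i y hm => ?_).of_eq (by simp [colN, Fin.val_inj, ha, hb]))
  simp only [Fin.val_inj]
  refine h.qCommute_t_quotient ((S.isPath d).white_of_mem hm) (iff_of_false ?_ ?_)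
  · intro hm'
    rcases List.mem_cons.1 hm' with e | hm'
    · rw [e] at hm
      exact (h.mem_or_mem_of_mem hm).elim hda hdb
    · exact hda (h.last _ d a (h.path_left.precedes_of_mem_right hm').2.2 hm
        (by rw [h.left]; simp_all))
  · intro hm'
    rcases List.mem_cons.1 hm' with e | hm'
    · rw [e] at hm
      exact (h.mem_or_mem_of_mem hm).elim hda hdb
    · exact hdb (h.last _ d b (h.path_down.precedes_of_mem_right hm').2.2 hm
        (by simp [h.down, hm']))

lemma commute_head (h : IsTailSwap S S' a b r c c' A B A' B') :
    Commute (D.unitPathWeight (A' ++ [.sq r c]) * (D.t r c)⁻¹)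
      (D.fromSquare r c (.sq r c :: .sq r c' :: B) * (D.fromSquare r c (.sq r c :: B'))⁻¹) := by
  have hz := D.commute_q
  have hp := h.path_down
  have key : ∀ i y, CVertex.sq i y ∈ A' ++ [CVertex.sq r c] →
      QCommute D.q ((if y = κ (S.σ a) then 1 else 0) - if y = κ (S.σ b) then 1 else 0) (D.t i y)
        (D.fromSquare r c (.sq r c :: .sq r c' :: B) *
          (D.fromSquare r c (.sq r c :: B'))⁻¹) := by
    intro i y hm
    refine h.qCommute_t_quotient (hp.white_of_mem (by simp at hm ⊢; tauto)) ?_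
    rcases List.mem_append.1 hm with hm | hm
    · have hl := (hp.precedes_of_mem_left hm).2.2
      refine iff_of_false ?_ ?_
      all_goals
        intro hm'
        rcases List.mem_cons.1 hm' with e | hm'
        · exact later_irrefl _ (e ▸ hl)
      · have := (h.path_left.precedes_of_mem_right hm').2.2
        unfold Later at *; omega
      · have := (hp.precedes_of_mem_right hm').2.2
        unfold Later at *; omega
    · rw [List.mem_singleton.1 hm]
      simp
  have h1 := QMData.qCommute_path_of_forall
    (fun y => (if y = (κ (S.σ a)).val then 1 else 0) - if y = (κ (S.σ b)).val then 1 else 0)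
    hp.before (by simp) fun i y hm => by simpa only [Fin.val_inj] using key i y hm
  exact QCommute.zero_iff.1 ((h1.mul_left hz ((key r c (by simp)).inv_left hz)).of_eq
    (by simp [colN, Fin.val_inj]))

end IsTailSwap

lemma prod_map_finRange_eq_of_swap {G : Type*} [Group G] {k : ℕ} {a b : Fin k} (hab : a < b)
    {F F' : Fin k → G} {z α β ρ ρ' : G} (hz : ∀ g, Commute z g) (hρ : QCommute z 1 ρ ρ')
    (ha : F a = α * ρ) (hb : F b = β * ρ') (ha' : F' a = α * ρ') (hb' : F' b = β * ρ)
    (hF : ∀ d, d ≠ a → d ≠ b → F' d = F d) (hc : ∀ d, d ≠ a → d ≠ b → Commute (F d) (ρ * ρ'⁻¹))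
    (hβ : Commute β (ρ * ρ'⁻¹)) :
    ((List.finRange k).map F).prod = z * ((List.finRange k).map F').prod := by
  obtain ⟨L₁, T, h⟩ := List.append_of_mem (List.mem_finRange a)
  have hpw := h ▸ List.pairwise_lt_finRange k
  obtain ⟨-, hT, hL₁⟩ := List.pairwise_append.1 hpw
  have hbT : b ∈ T := by
    have := h ▸ List.mem_finRange b
    simp only [List.mem_append, List.mem_cons] at this
    rcases this with hb | hb | hb
    · exact absurd (hL₁ b hb a (by simp)) hab.not_gt
    · exact absurd hb hab.ne'
    · exact hb
  obtain ⟨L₂, L₃, rfl⟩ := List.append_of_mem hbT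
  obtain ⟨haT, hT⟩ := List.pairwise_cons.1 hT
  obtain ⟨-, hL₃, hL₂⟩ := List.pairwise_append.1 hT
  have e₁ : L₁.map F' = L₁.map F := List.map_congr_left fun d hd =>
    hF d (hL₁ d hd a (by simp)).ne (hL₁ d hd b (by simp)).ne
  have hne₂ : ∀ d ∈ L₂, d ≠ a ∧ d ≠ b := fun d hd =>
    ⟨(haT d (by simp [hd])).ne', (hL₂ d hd b (by simp)).ne⟩
  have e₂ : L₂.map F' = L₂.map F := List.map_congr_left fun d hd =>
    hF d (hne₂ d hd).1 (hne₂ d hd).2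
  have e₃ : L₃.map F' = L₃.map F := List.map_congr_left fun d hd =>
    hF d (haT d (by simp [hd])).ne' ((List.pairwise_cons.1 hL₃).1 d hd).ne'
  have hM : Commute (L₂.map F).prod (ρ * ρ'⁻¹) := Commute.list_prod_left _ _ fun u hu => by
    obtain ⟨d, hd, rfl⟩ := List.mem_map.1 hu
    exact hc d (hne₂ d hd).1 (hne₂ d hd).2
  rw [h]
  simp only [List.map_append, List.map_cons, List.prod_append, List.prod_cons, e₁, e₂, e₃, ha, hb,
    ha', hb']
  set M := (L₂.map F).prod
  set X := (L₁.map F).prod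
  set Y := (L₃.map F).prod
  have hMβ : M * β * (ρ * ρ'⁻¹) = ρ * ρ'⁻¹ * (M * β) := (hM.mul_left hβ).eq
  have h1 : ρ = z * (ρ' * (ρ * ρ'⁻¹)) := by
    rw [QCommute, zpow_one] at hρ
    rw [← mul_assoc, ← mul_assoc, mul_assoc z, ← hρ, mul_inv_cancel_right]
  calc X * (α * ρ * (M * (β * ρ' * Y)))
      = X * α * z * (ρ' * (ρ * ρ'⁻¹ * (M * β)) * ρ' * Y) := by
        nth_rw 1 [h1]
        simp only [mul_assoc]
    _ = z * (X * α) * (ρ' * (M * β * (ρ * ρ'⁻¹)) * ρ' * Y) := by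
        rw [hMβ, (hz (X * α)).eq]
    _ = z * (X * (α * ρ' * (M * (β * ρ * Y)))) := by group

namespace IsTailSwap

variable {R : Type u} [Ring R] {m n : ℕ} (D : QMData R m n) {white : Fin m → Fin n → Bool} {k : ℕ}
  {ι : Fin k → Fin m} {κ : Fin k → Fin n} {S S' : PathSys white ι κ} {a b : Fin k} {r : Fin m}
  {c c' : Fin n} {A B A' B' : List (CVertex m n)}

lemma _root_.PathSys.coe_prod_unitPathWeight (S : PathSys white ι κ) :
    ((((List.finRange k).map fun d => D.unitPathWeight (S.P d)).prod : Rˣ) : R) = S.weight D := by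
  rw [PathSys.weight, ← Units.coeHom_apply, map_list_prod, List.map_map]
  congr 2
  ext d
  simp [QMData.coe_unitPathWeight]

theorem weight_eq (h : IsTailSwap S S' a b r c c' A B A' B') (hκ : StrictMono κ) (hab : a < b) :
    S.weight D = D.q * S'.weight D := by
  have hw : ∀ A B, D.unitPathWeight (A ++ .sq r c :: B) =
      D.unitPathWeight (A ++ [.sq r c]) * (D.t r c)⁻¹ * D.fromSquare r c (.sq r c :: B) := by
    intro A B
    rw [D.unitPathWeight_append, QMData.fromSquare, mul_assoc, inv_mul_cancel_left]
  rw [← S.coe_prod_unitPathWeight, ← S'.coe_prod_unitPathWeight, ← Units.val_mul]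
  congr 1
  exact prod_map_finRange_eq_of_swap hab D.commute_q (h.qCommute_tails hκ)
    (by rw [h.left, hw]) (by rw [h.down, hw]) (by rw [h.left', hw]) (by rw [h.down', hw])
    (fun d hda hdb => by rw [h.others d hda hdb]) (fun d => h.commute_of_ne hκ) h.commute_head

end IsTailSwap

lemma invCount_mul_swap {k : ℕ} {σ : Equiv.Perm (Fin k)} {a b : Fin k} (hab : a < b)
    (h : (σ b).val = (σ a).val + 1) : invCount (σ * Equiv.swap a b) = invCount σ + 1 := by
  unfold invCount
  rw [← Finset.card_insert_of_notMem (a := (a, b)) (by simp; omega)]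
  congr 1
  ext ⟨p, p'⟩
  have h1 : ∀ d, d ≠ a → (σ d).val ≠ (σ a).val := fun d hd e => hd (σ.injective (Fin.ext e))
  have h2 : ∀ d, d ≠ b → (σ d).val ≠ (σ b).val := fun d hd e => hd (σ.injective (Fin.ext e))
  have hp := h1 p
  have hp' := h1 p'
  have hq := h2 p
  have hq' := h2 p'
  simp only [Finset.mem_filter, Finset.mem_univ, true_and, Finset.mem_insert, Prod.mk.injEq,
    Equiv.Perm.mul_apply, Equiv.swap_apply_def, Fin.lt_def]
  grind

section Cancellation

variable {R : Type u} [Ring R] {m n : ℕ} (D : QMData R m n) {white : Fin m → Fin n → Bool} {k : ℕ}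
  {ι : Fin k → Fin m} {κ : Fin k → Fin n} {S S' : PathSys white ι κ}

lemma IsTailSwap.sgnq_mul_weight_add {a b : Fin k} {r : Fin m} {c c' : Fin n}
    {A B A' B' : List (CVertex m n)} (hC : IsCauchon white) (hκ : StrictMono κ)
    (h : IsTailSwap S S' a b r c c' A B A' B') (hab : a < b) :
    S.sgnq D * S.weight D + S'.sgnq D * S'.weight D = 0 := by
  rw [h.weight_eq D hκ hab, PathSys.sgnq, PathSys.sgnq, h.perm,
    invCount_mul_swap hab (h.perm_apply_eq_succ hC hκ), pow_succ]
  simp [mul_assoc]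

lemma TailSwapped.sgnq_mul_weight_add (hC : IsCauchon white) (hκ : StrictMono κ)
    (h : TailSwapped S S') : S.sgnq D * S.weight D + S'.sgnq D * S'.weight D = 0 := by
  obtain ⟨a, b, r, c, c', A, B, A', B', h⟩ := h
  rcases h.ne.lt_or_gt with hab | hab
  · exact h.sgnq_mul_weight_add D hC hκ hab
  · rw [add_comm]
    exact h.symm.sgnq_mul_weight_add D hC hκ hab

end Cancellation

lemma finsum_eq_zero_of_involution {α M : Type*} [AddCommMonoid M] {f : α → M} (g : α → α)
    (hg : ∀ x, g (g x) = x) (hne : ∀ x, g x ≠ x) (hf : ∀ x, f x + f (g x) = 0) :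
    ∑ᶠ x, f x = 0 := by
  by_cases hs : (Function.support f).Finite
  · rw [finsum_eq_sum f hs]
    refine Finset.sum_involution (fun x _ => g x) (fun x _ => hf x) (fun x _ _ => hne x)
      (fun x hx => ?_) (fun x _ => hg x)
    simp only [Set.Finite.mem_toFinset, Function.mem_support] at hx ⊢
    intro h0
    have := hf x
    rw [h0, add_zero] at this
    exact hx this
  · exact finsum_of_infinite_support hs

/-- the signed weighted sum over all non-vertex-disjoint
`(R_I, C_J)`-path systems vanishes. -/
theorem sum_non_disjoint_systems_eq_zero {R : Type u} [Ring R] {m n : ℕ} (D : QMData R m n)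
    (white : Fin m → Fin n → Bool) (hC : IsCauchon white)
    {k : ℕ} (ι : Fin k → Fin m) (κ : Fin k → Fin n)
    (hι : StrictMono ι) (hκ : StrictMono κ) :
    ∑ᶠ S : {S : PathSys white ι κ // ¬ S.VertexDisjoint},
      S.1.sgnq D * S.1.weight D = 0 := by
  have hex : ∀ S : {S : PathSys white ι κ // ¬ S.VertexDisjoint},
      ∃ S' : {S : PathSys white ι κ // ¬ S.VertexDisjoint}, TailSwapped S.1 S'.1 := fun S => by
    obtain ⟨S', h⟩ := exists_tailSwapped hι hκ S.2
    exact ⟨⟨S', h.symm.not_vertexDisjoint⟩, h⟩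
  choose g hg using hex
  exact finsum_eq_zero_of_involution g
    (fun S => Subtype.ext ((hg (g S)).unique (hg S).symm))
    (fun S h => (hg S).ne (congrArg Subtype.val h))
    (fun S => (hg S).sgnq_mul_weight_add D hC hκ)
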